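/- arXiv:2102.01071 — 3 statements merged into one kernel-verified Lean document; each statement's English description precedes it below -/
import Mathlib

section
/- Let i ≠ j be vertices of G such that ⟨ij⟩ is an edge of G. Then α_ij(G) > α_ij(G − ⟨ij⟩); that is, deleting the link ⟨ij⟩ strictly decreases the local resource availability of i from j. -/
open Finset
open scoped Classical

variable {V : Type*} [Fintype V] [DecidableEq V]

/-- Harmonic centrality (closeness) of `u` in `G`:  `Φ_u(G) = ∑_{v ≠ u} 1/d_uv(G)`,
with the convention `1/∞ = 0` (Mathlib's `SimpleGraph.dist` is `0` on unreachable pairs,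
and `(0 : ℝ)⁻¹ = 0`). -/
noncomputable def Phi (G : SimpleGraph V) (u : V) : ℝ :=
  ∑ v ∈ Finset.univ.filter (· ≠ u), ((G.dist u v : ℝ))⁻¹

/-- Local resource availability of `u` from `v` in `G`:
`α_uv(G) = p(1−q)/(d_uv(G)·Φ_v(G))` when `u` and `v` are connected in `G`, else `0`. -/
noncomputable def alpha (p q : ℝ) (G : SimpleGraph V) (u v : V) : ℝ :=
  if G.Reachable u v then p * (1 - q) / ((G.dist u v : ℝ) * Phi G v) else 0

namespace SimpleGraph.Walk

/-- If every edge of `G` can be replaced by a walk of length at most `k` in `H`, then every walk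
in `G` can be replaced by a walk in `H` that is at most `k` times as long. -/
theorem exists_length_le_mul {W : Type*} {G H : SimpleGraph W} {k : ℕ}
    (hk : ∀ a b, G.Adj a b → ∃ w : H.Walk a b, w.length ≤ k) {a b : W} (w : G.Walk a b) :
    ∃ w' : H.Walk a b, w'.length ≤ k * w.length := by
  induction w with
  | nil => exact ⟨.nil, by simp⟩
  | cons h _ ih =>
    obtain ⟨w₁, h₁⟩ := hk _ _ h
    obtain ⟨w₂, h₂⟩ := ih
    refine ⟨w₁.append w₂, ?_⟩
    rw [length_append, length_cons, mul_add, mul_one]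
    omega

end SimpleGraph.Walk

namespace SimpleGraph

theorem exists_walk_deleteEdges_of_adj {W : Type*} {G : SimpleGraph W} {i j : W}
    (hij : i ≠ j) (hr : (G.deleteEdges {s(i, j)}).Reachable i j) {a b : W} (hab : G.Adj a b) :
    ∃ w : (G.deleteEdges {s(i, j)}).Walk a b,
      w.length ≤ (G.deleteEdges {s(i, j)}).dist i j := by
  obtain ⟨w, hw⟩ := hr.exists_walk_length_eq_dist
  by_cases h : s(a, b) = s(i, j)
  · rcases Sym2.eq_iff.1 h with ⟨rfl, rfl⟩ | ⟨rfl, rfl⟩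
    · exact ⟨w, hw.le⟩
    · exact ⟨w.reverse, by rw [Walk.length_reverse, hw]⟩
  · have hab' : (G.deleteEdges {s(i, j)}).Adj a b := by
      rw [deleteEdges_adj]
      exact ⟨hab, h⟩
    exact ⟨hab'.toWalk, hr.pos_dist_of_ne hij⟩

end SimpleGraph

theorem Phi_pos_of_adj {W : Type*} [Fintype W] [DecidableEq W] {G : SimpleGraph W} {u v : W}
    (h : G.Adj u v) : 0 < Phi G u := by
  refine Finset.sum_pos' (fun _ _ => by positivity) ⟨v, by simp [h.ne'], ?_⟩
  simp [SimpleGraph.dist_eq_one_iff_adj.2 h]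

theorem Phi_lt_dist_mul_Phi_deleteEdges {W : Type*} [Fintype W] [DecidableEq W]
    {G : SimpleGraph W} {i j : W} (hij : G.Adj i j)
    (hr : (G.deleteEdges {s(i, j)}).Reachable i j) :
    Phi G j < (G.deleteEdges {s(i, j)}).dist i j * Phi (G.deleteEdges {s(i, j)}) j := by
  set H := G.deleteEdges {s(i, j)} with hH
  have hle : H ≤ G := SimpleGraph.deleteEdges_le _
  have hd : 1 < H.dist i j := by
    have h_pos := hr.pos_dist_of_ne hij.ne
    have h_ne : H.dist i j ≠ 1 := by
      rw [Ne, SimpleGraph.dist_eq_one_iff_adj, hH, SimpleGraph.deleteEdges_adj]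
      simp
    omega
  unfold Phi
  rw [Finset.mul_sum]
  refine Finset.sum_lt_sum (fun v hv => ?_) ?_
  · have hvj : v ≠ j := by simpa using hv
    by_cases hG : G.Reachable j v
    · obtain ⟨w, hw⟩ := hG.exists_walk_length_eq_dist
      obtain ⟨w', hw'⟩ := w.exists_length_le_mul (H := H) (k := H.dist i j)
        fun a b hab => SimpleGraph.exists_walk_deleteEdges_of_adj hij.ne hr hab
      have hpos : (0 : ℝ) < G.dist j v := by exact_mod_cast hG.pos_dist_of_ne hvj.symm
      have hpos' : (0 : ℝ) < H.dist j v := by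
        exact_mod_cast (SimpleGraph.Walk.reachable w').pos_dist_of_ne hvj.symm
      have hmul : (H.dist j v : ℝ) ≤ H.dist i j * G.dist j v := by
        exact_mod_cast (SimpleGraph.dist_le w').trans (hw ▸ hw')
      rw [← div_eq_mul_inv, inv_eq_one_div, div_le_div_iff₀ hpos hpos']
      linarith
    · rw [SimpleGraph.dist_eq_zero_of_not_reachable hG]
      simp only [Nat.cast_zero, inv_zero]
      positivity
  · obtain ⟨w⟩ := hr.symm
    cases w with
    | nil => exact absurd rfl hij.ne
    | @cons _ v _ h _ =>
      refine ⟨v, by simp [h.ne'], ?_⟩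
      rw [SimpleGraph.dist_eq_one_iff_adj.2 h, SimpleGraph.dist_eq_one_iff_adj.2 (hle h)]
      simpa using hd

/-- deleting the link `⟨ij⟩` strictly decreases the local resource
availability of `i` from `j`. -/
theorem stmt_3 (G : SimpleGraph V) (i j : V) (hij : i ≠ j) (hije : G.Adj i j)
    (p q : ℝ) (hp0 : 0 < p) (hp1 : p < 1) (hq0 : 0 < q) (hq1 : q < 1) :
    alpha p q G i j > alpha p q (G.deleteEdges {s(i, j)}) i j := by
  have hc : 0 < p * (1 - q) := mul_pos hp0 (sub_pos.2 hq1)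
  have hPhi : 0 < Phi G j := Phi_pos_of_adj hije.symm
  unfold alpha
  rw [if_pos hije.reachable, SimpleGraph.dist_eq_one_iff_adj.2 hije, Nat.cast_one, one_mul]
  split_ifs with hr
  · exact div_lt_div_of_pos_left hc hPhi (Phi_lt_dist_mul_Phi_deleteEdges hije hr)
  · exact div_pos hc hPhi
end

section
/- Let i, j, k be pairwise distinct vertices of G such that ⟨ij⟩ is not an edge of G and ⟨ik⟩ is an edge of G. Then: (1) if d_kj(G) ≤ 2 (in particular, if k is adjacent to j), then α_ik(G + ⟨ij⟩) = α_ik(G); (2) if d_kj(G) > 2 (including the case d_kj(G) = ∞), then α_ik(G) > α_ik(G + ⟨ij⟩). -/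
open Finset
open scoped Classical

variable {V : Type*} [Fintype V] [DecidableEq V]

/-- A function that grows by at most one along each edge and vanishes at `u` is bounded by the
distance from `u`. -/
lemma SimpleGraph.le_edist_of_forall_adj {W : Type*} (H : SimpleGraph W) (f : W → ℕ∞)
    (hf : ∀ a b, H.Adj a b → f b ≤ f a + 1) {u : W} (hu : f u = 0) (v : W) :
    f v ≤ H.edist u v := by
  have hwalk : ∀ {a b : W} (w : H.Walk a b), f b ≤ f a + w.length := by
    intro a b w
    induction w with
    | nil => simp
    | cons h w ih =>
      refine ih.trans ?_
      rw [SimpleGraph.Walk.length_cons, Nat.cast_add, Nat.cast_one, add_comm (w.length : ℕ∞),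
        ← add_assoc]
      gcongr
      exact hf _ _ h
  by_cases h : H.edist u v = ⊤
  · simp [h]
  · obtain ⟨w, hw⟩ := SimpleGraph.exists_walk_of_edist_ne_top h
    simpa [hu, hw] using hwalk w

/-- Adding an edge from a neighbour of `k` to a vertex at distance at most two from `k` does not
change the distances from `k`. -/
lemma SimpleGraph.edist_sup_edge_eq {W : Type*} {G : SimpleGraph W} {i j k : W}
    (hik : G.Adj i k) (hkj : G.edist k j ≤ 2) (v : W) :
    (G ⊔ SimpleGraph.edge i j).edist k v = G.edist k v := by
  refine le_antisymm (SimpleGraph.edist_anti le_sup_left) ?_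
  refine SimpleGraph.le_edist_of_forall_adj _ (G.edist k) ?_ SimpleGraph.edist_self v
  have hki : G.edist k i = 1 := SimpleGraph.edist_eq_one_iff_adj.2 hik.symm
  intro a b hab
  rw [SimpleGraph.sup_adj, SimpleGraph.edge_adj] at hab
  obtain hab | ⟨⟨rfl, rfl⟩ | ⟨rfl, rfl⟩, -⟩ := hab
  · rw [← SimpleGraph.edist_eq_one_iff_adj.2 hab]
    exact SimpleGraph.edist_triangle
  · rwa [hki, one_add_one_eq_two]
  · rw [hki]
    exact le_add_self

/-- Reciprocal distances do not decrease when edges are added. -/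
lemma SimpleGraph.inv_dist_le_inv_dist {W : Type*} {G H : SimpleGraph W} (h : G ≤ H) (u v : W) :
    ((G.dist u v : ℝ))⁻¹ ≤ ((H.dist u v : ℝ))⁻¹ := by
  by_cases hr : G.Reachable u v
  · obtain rfl | hne := eq_or_ne u v
    · simp
    · have hpos := (hr.mono h).pos_dist_of_ne hne
      have hle := hr.dist_anti h
      gcongr
  · simp [SimpleGraph.dist_eq_zero_of_not_reachable hr]

/-- Harmonic centrality strictly increases when edges are added and some distance shrinks. -/
lemma Phi_lt_Phi {G H : SimpleGraph V} (h : G ≤ H) {u v : V} (huv : u ≠ v)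
    (hlt : H.edist u v < G.edist u v) : Phi G u < Phi H u := by
  refine Finset.sum_lt_sum (fun w _ => SimpleGraph.inv_dist_le_inv_dist h u w)
    ⟨v, by simp [huv.symm], ?_⟩
  have hrH : H.Reachable u v := SimpleGraph.reachable_of_edist_ne_top hlt.ne_top
  have hpos := hrH.pos_dist_of_ne huv
  by_cases hr : G.Reachable u v
  · rw [← hr.coe_dist_eq_edist, ← hrH.coe_dist_eq_edist, Nat.cast_lt] at hlt
    gcongr
  · rw [SimpleGraph.dist_eq_zero_of_not_reachable hr]
    simpa using hpos

lemma Phi_pos {G : SimpleGraph V} {u v : V} (h : G.Adj u v) : 0 < Phi G u := by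
  refine Finset.sum_pos' (fun w _ => by positivity) ⟨v, by simp [h.ne'], ?_⟩
  simp [SimpleGraph.dist_eq_one_iff_adj.2 h]

lemma alpha_eq_of_adj (p q : ℝ) {G : SimpleGraph V} {u v : V} (h : G.Adj u v) :
    alpha p q G u v = p * (1 - q) / Phi G v := by
  simp [alpha, h.reachable, SimpleGraph.dist_eq_one_iff_adj.2 h]

/-- for `k ∈ η_i(G)` with `⟨ij⟩ ∉ G`:
if `d_kj(G) ≤ 2` then `α_ik(G + ⟨ij⟩) = α_ik(G)`;
if `d_kj(G) > 2` (incl. `∞`) then `α_ik(G) > α_ik(G + ⟨ij⟩)`. -/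
theorem stmt_5 (G : SimpleGraph V) (i j k : V)
    (hij : i ≠ j) (hik : i ≠ k) (hjk : j ≠ k)
    (hije : ¬ G.Adj i j) (hike : G.Adj i k)
    (p q : ℝ) (hp0 : 0 < p) (hp1 : p < 1) (hq0 : 0 < q) (hq1 : q < 1) :
    (G.edist k j ≤ 2 →
        alpha p q (G ⊔ SimpleGraph.edge i j) i k = alpha p q G i k) ∧
      (2 < G.edist k j →
        alpha p q G i k > alpha p q (G ⊔ SimpleGraph.edge i j) i k) := by
  have hle : G ≤ G ⊔ SimpleGraph.edge i j := le_sup_left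
  rw [alpha_eq_of_adj p q hike, alpha_eq_of_adj p q (hle hike)]
  refine ⟨fun h => ?_, fun h => ?_⟩
  · simp only [Phi, SimpleGraph.dist, SimpleGraph.edist_sup_edge_eq hike h]
  · have hadj : (G ⊔ SimpleGraph.edge i j).Adj i j := by
      simp [SimpleGraph.edge_adj, hij]
    have h2 : (G ⊔ SimpleGraph.edge i j).edist k j ≤ 2 := by
      rw [← one_add_one_eq_two]
      nth_rewrite 1 [← SimpleGraph.edist_eq_one_iff_adj.2 (hle hike).symm]
      rw [← SimpleGraph.edist_eq_one_iff_adj.2 hadj]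
      exact SimpleGraph.edist_triangle
    have hpos : 0 < Phi G k := Phi_pos hike.symm
    have hlt := Phi_lt_Phi hle hjk.symm (h2.trans_lt h)
    have hq : 0 < 1 - q := sub_pos.2 hq1
    exact div_lt_div_of_pos_left (by positivity) hpos hlt
end

section
/- Suppose G is connected and has at least three vertices. Let i, j, k be pairwise distinct vertices of G such that ⟨ij⟩ is not an edge of G. If Φ_k(G) = Φ_k(G + ⟨ij⟩), then γ_k(G) > γ_k(G + ⟨ij⟩); that is, k experiences negative spillover on addition of the link ⟨ij⟩. -/
open Finset
open scoped Classical

variable {V : Type*} [Fintype V] [DecidableEq V]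

/-- Global resource availability of `u` in `G`: `γ_u(G) = 1 − Π_{v ≠ u}(1 − α_uv(G))`. -/
noncomputable def gammaRA (p q : ℝ) (G : SimpleGraph V) (u : V) : ℝ :=
  1 - ∏ v ∈ Finset.univ.filter (· ≠ u), (1 - alpha p q G u v)

/-- Inverse distances can only grow when edges are added to a connected graph. -/
lemma inv_dist_le_inv_dist_of_le {W : Type*} {G H : SimpleGraph W} (hG : G.Connected)
    (h : G ≤ H) (u v : W) :
    ((G.dist u v : ℝ))⁻¹ ≤ ((H.dist u v : ℝ))⁻¹ := by
  rcases eq_or_ne u v with rfl | huv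
  · simp
  · have hpos : 0 < H.dist u v := (hG.mono h).pos_dist_of_ne huv
    have hle : H.dist u v ≤ G.dist u v := (hG u v).dist_anti h
    gcongr

lemma Phi_le_Phi_of_le {G H : SimpleGraph V} (hG : G.Connected) (h : G ≤ H) (u : V) :
    Phi G u ≤ Phi H u :=
  Finset.sum_le_sum fun v _ => inv_dist_le_inv_dist_of_le hG h u v

/-- If adding edges leaves the closeness of `u` unchanged, it leaves all distances from `u`
unchanged. -/
lemma dist_eq_of_Phi_eq {G H : SimpleGraph V} (hG : G.Connected) (h : G ≤ H) {u : V}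
    (hPhi : Phi G u = Phi H u) {v : V} (hv : v ≠ u) : G.dist u v = H.dist u v := by
  have := (Finset.sum_eq_sum_iff_of_le
    fun v _ => inv_dist_le_inv_dist_of_le hG h u v).1 hPhi v (by simp [hv])
  exact_mod_cast inv_injective this

/-- Joining two non-adjacent vertices strictly increases the closeness of an endpoint. -/
lemma Phi_lt_Phi_sup_edge {G : SimpleGraph V} (hG : G.Connected) {i j : V} (hij : i ≠ j)
    (hije : ¬ G.Adj i j) : Phi G i < Phi (G ⊔ SimpleGraph.edge i j) i := by
  refine Finset.sum_lt_sum (fun v _ => inv_dist_le_inv_dist_of_le hG le_sup_left i v)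
    ⟨j, by simp [hij.symm], ?_⟩
  have hone : (G ⊔ SimpleGraph.edge i j).dist i j = 1 :=
    SimpleGraph.dist_eq_one_iff_adj.2 (Or.inr (by simp [SimpleGraph.edge_adj, hij]))
  have hlt : (1 : ℝ) < G.dist i j := by
    exact_mod_cast hG.one_lt_dist_of_ne_of_not_adj hij hije
  rw [hone, Nat.cast_one, inv_one]
  exact inv_lt_one_of_one_lt₀ hlt

lemma one_le_dist_mul_Phi {G : SimpleGraph V} (hG : G.Connected) {u v : V} (huv : v ≠ u) :
    1 ≤ (G.dist u v : ℝ) * Phi G v := by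
  have hpos : (0 : ℝ) < G.dist u v := by exact_mod_cast hG.pos_dist_of_ne huv.symm
  have hle : ((G.dist v u : ℝ))⁻¹ ≤ Phi G v :=
    Finset.single_le_sum (f := fun w => ((G.dist v w : ℝ))⁻¹)
      (fun w _ => by positivity) (by simp [huv.symm])
  rw [SimpleGraph.dist_comm] at hle
  calc (1 : ℝ) = G.dist u v * (G.dist u v : ℝ)⁻¹ := (mul_inv_cancel₀ hpos.ne').symm
    _ ≤ G.dist u v * Phi G v := by gcongr

/-- in a connected network with at least three agents, an agent
`k ∉ {i,j}` whose closeness is unchanged by the addition of the link `⟨ij⟩`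
experiences negative spillover. -/
theorem stmt_13 (G : SimpleGraph V) (hconn : G.Connected) (hcard : 3 ≤ Fintype.card V)
    (i j k : V) (hij : i ≠ j) (hik : i ≠ k) (hjk : j ≠ k) (hije : ¬ G.Adj i j)
    (p q : ℝ) (hp0 : 0 < p) (hp1 : p < 1) (hq0 : 0 < q) (hq1 : q < 1)
    (hPhi : Phi G k = Phi (G ⊔ SimpleGraph.edge i j) k) :
    gammaRA p q G k > gammaRA p q (G ⊔ SimpleGraph.edge i j) k := by
  have hle : G ≤ G ⊔ SimpleGraph.edge i j := le_sup_left
  have hconn' := hconn.mono hle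
  have hc0 : 0 < p * (1 - q) := mul_pos hp0 (by linarith)
  have hc1 : p * (1 - q) < 1 := by nlinarith
  refine sub_lt_sub_left (Finset.prod_lt_prod ?_ ?_ ⟨i, by simp [hik], ?_⟩) 1
  · intro v hv
    have hvk : v ≠ k := by simpa using hv
    have h1 := one_le_dist_mul_Phi hconn hvk
    rw [alpha, if_pos (hconn k v), sub_pos, div_lt_one (by linarith)]
    linarith
  · intro v hv
    have hvk : v ≠ k := by simpa using hv
    have h1 := one_le_dist_mul_Phi hconn hvk
    rw [alpha, alpha, if_pos (hconn k v), if_pos (hconn' k v),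
      ← dist_eq_of_Phi_eq hconn hle hPhi hvk]
    have hΦ := Phi_le_Phi_of_le hconn hle v
    gcongr
  · have h1 := one_le_dist_mul_Phi hconn hik
    have hd : (0 : ℝ) < G.dist k i := by exact_mod_cast hconn.pos_dist_of_ne hik.symm
    rw [alpha, alpha, if_pos (hconn k i), if_pos (hconn' k i),
      ← dist_eq_of_Phi_eq hconn hle hPhi hik]
    have hΦ := Phi_lt_Phi_sup_edge hconn hij hije
    gcongr
end
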